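/- arXiv:1705.09609 — 4 statements merged into one kernel-verified Lean document; each statement's English description precedes it below -/
import Mathlib

section
/- Let R be a nonempty finite set, let I be a nonempty finite index set, let Z : I × R → {0,1}, and let ε > 0 be a real number such that for every i ∈ I, the fraction of strings r ∈ R with Z(i,r) = 1 is at most ε (equivalently, Pr_{r uniform in R}[Z(i,r)=1] ≤ ε). Then for every positive integer t with t > ln(|I|)/(2ε²), there exist (not necessarily distinct) elements r_1, r_2, …, r_t ∈ R such that for every i ∈ I, the number of indices j ∈ {1,…,t} with Z(i, r_j) = 1 is at most 2εt. -/
open scoped Classical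

open MeasureTheory ProbabilityTheory in
/-- Hoeffding's lemma for an indicator under the uniform distribution on a finite type. -/
theorem sum_exp_indicator_sub_mean_le {R : Type*} [Fintype R] [Nonempty R]
    (A : R → Bool) (s : ℝ) :
    ∑ r, Real.exp (s * ((if A r = true then 1 else 0) -
        ((Finset.univ.filter fun r : R => A r = true).card : ℝ) / Fintype.card R)) ≤
      Fintype.card R * Real.exp (s ^ 2 / 8) := by
  let _ : MeasurableSpace R := ⊤
  set X : R → ℝ := fun r => if A r = true then 1 else 0 with hX
  set μ : Measure R := (PMF.uniformOfFintype R).toMeasure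
  have hcard : (0 : ℝ) < Fintype.card R := by exact_mod_cast Fintype.card_pos
  have integral_eq (g : R → ℝ) : ∫ r, g r ∂μ = (∑ r, g r) / Fintype.card R := by
    rw [PMF.integral_eq_sum]
    simp [← Finset.mul_sum, div_eq_inv_mul]
  have h := (hasSubgaussianMGF_of_mem_Icc (μ := μ) (X := X) (a := 0) (b := 1)
    (measurable_from_top.aemeasurable)
    (Filter.Eventually.of_forall fun r => by
      simp only [hX]
      split_ifs <;> simp)).mgf_le s
  have hmean : ∫ r, X r ∂μ =
      ((Finset.univ.filter fun r : R => A r = true).card : ℝ) / Fintype.card R := by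
    rw [integral_eq]
    simp [hX]
  rw [mgf, integral_eq, hmean, div_le_iff₀' hcard] at h
  refine h.trans_eq ?_
  congr 2
  norm_num
  ring

/-- Probabilistic-method kernel of the paper's generalization of Newman's Theorem:
if for every `i` the fraction of `r ∈ R` with `Z i r = 1` is at most `ε`, then for
every positive integer `t > ln |I| / (2 ε²)` there exists a selection
`r_1, …, r_t ∈ R` such that for every `i`, at most `2 ε t` of the indices `j`
satisfy `Z i (r_j) = 1`. -/
theorem stmt_1 {R I : Type*} [Fintype R] [Fintype I] [Nonempty R] [Nonempty I]
    (Z : I → R → Bool) (ε : ℝ) (hε : 0 < ε)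
    (hZ : ∀ i : I,
      ((Finset.univ.filter fun r : R => Z i r = true).card : ℝ) / (Fintype.card R) ≤ ε)
    (t : ℕ) (ht0 : 0 < t)
    (ht : Real.log (Fintype.card I) / (2 * ε ^ 2) < (t : ℝ)) :
    ∃ f : Fin t → R, ∀ i : I,
      ((Finset.univ.filter fun j : Fin t => Z i (f j) = true).card : ℝ) ≤ 2 * ε * t := by
  by_contra! hbad
  have hcard : (0 : ℝ) < Fintype.card R := by exact_mod_cast Fintype.card_pos
  have hI : (0 : ℝ) < Fintype.card I := by exact_mod_cast Fintype.card_pos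
  have htR : (0 : ℝ) < t := by exact_mod_cast ht0
  let p : I → ℝ := fun i =>
    ((Finset.univ.filter fun r : R => Z i r = true).card : ℝ) / Fintype.card R
  set w : I → R → ℝ := fun i r =>
    Real.exp (4 * ε * ((if Z i r = true then 1 else 0) - p i)) with hw
  have hprod (f : Fin t → R) (i : I) : ∏ j, w i (f j) =
      Real.exp (4 * ε *
        ((Finset.univ.filter fun j : Fin t => Z i (f j) = true).card - t * p i)) := by
    simp [hw, ← Real.exp_sum, ← Finset.mul_sum, Finset.sum_sub_distrib]
  have hlower (f : Fin t → R) : Real.exp (4 * ε * (ε * t)) ≤ ∑ i, ∏ j, w i (f j) := by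
    obtain ⟨i, hi⟩ := hbad f
    refine le_trans ?_ (Finset.single_le_sum (f := fun i => ∏ j, w i (f j))
      (fun i _ => Finset.prod_nonneg fun j _ => (Real.exp_pos _).le) (Finset.mem_univ i))
    simp only [hprod]
    have hpi : t * p i ≤ t * ε := mul_le_mul_of_nonneg_left (hZ i) htR.le
    gcongr
    linarith
  have hupper (i : I) : ∑ f : Fin t → R, ∏ j, w i (f j) ≤
      (Fintype.card R : ℝ) ^ t * Real.exp (2 * ε ^ 2 * t) := by
    calc ∑ f : Fin t → R, ∏ j, w i (f j) = (∑ r, w i r) ^ t := by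
          rw [Fintype.sum_pow]
      _ ≤ (Fintype.card R * Real.exp ((4 * ε) ^ 2 / 8)) ^ t :=
          pow_le_pow_left₀ (Finset.sum_nonneg fun r _ => (Real.exp_pos _).le)
            (sum_exp_indicator_sub_mean_le (Z i) (4 * ε)) t
      _ = (Fintype.card R : ℝ) ^ t * Real.exp (2 * ε ^ 2 * t) := by
          rw [mul_pow, ← Real.exp_nat_mul]
          ring_nf
  have htotal : (Fintype.card R : ℝ) ^ t * Real.exp (4 * ε * (ε * t)) ≤
      Fintype.card I * ((Fintype.card R : ℝ) ^ t * Real.exp (2 * ε ^ 2 * t)) := by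
    calc (Fintype.card R : ℝ) ^ t * Real.exp (4 * ε * (ε * t))
        = ∑ _f : Fin t → R, Real.exp (4 * ε * (ε * t)) := by simp
      _ ≤ ∑ f : Fin t → R, ∑ i, ∏ j, w i (f j) := Finset.sum_le_sum fun f _ => hlower f
      _ = ∑ i, ∑ f : Fin t → R, ∏ j, w i (f j) := Finset.sum_comm
      _ ≤ ∑ _i : I, (Fintype.card R : ℝ) ^ t * Real.exp (2 * ε ^ 2 * t) :=
          Finset.sum_le_sum fun i _ => hupper i
      _ = _ := by simp
  have hlt : (Fintype.card I : ℝ) < Real.exp (2 * ε ^ 2 * t) := by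
    rw [← Real.log_lt_iff_lt_exp hI]
    rwa [div_lt_iff₀' (by positivity)] at ht
  have hsplit : Real.exp (4 * ε * (ε * t)) =
      Real.exp (2 * ε ^ 2 * t) * Real.exp (2 * ε ^ 2 * t) := by
    rw [← Real.exp_add]
    ring_nf
  rw [hsplit, mul_left_comm, mul_left_comm (Fintype.card I : ℝ),
    mul_left_comm, mul_le_mul_iff_right₀ (by positivity)] at htotal
  exact absurd (le_of_mul_le_mul_right htotal (Real.exp_pos _)) (not_le.mpr hlt)
end

section
/- Fix a real constant γ ≥ 9 and a natural number N ≥ 2. Suppose k balls, with 1 ≤ k ≤ N, are thrown into k' ≥ k bins, each ball independently and uniformly at random. Then the probability that at least one bin receives at least γ·log₂(N) balls is less than 1/N^{(γ/3) − 2}. -/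
open scoped Classical

/-- The number of functions that are constantly `b` on `S`. -/
lemma card_filter_forall_mem_eq {α β : Type*} [Fintype α] [Fintype β] (S : Finset α) (b : β) :
    (Finset.univ.filter fun f : α → β => ∀ i ∈ S, f i = b).card
      = Fintype.card β ^ (Fintype.card α - S.card) := by
  have h : (Finset.univ.filter fun f : α → β => ∀ i ∈ S, f i = b)
      = Fintype.piFinset fun i => if i ∈ S then {b} else Finset.univ := by
    ext f
    simp only [Finset.mem_filter, Finset.mem_univ, true_and, Fintype.mem_piFinset]
    refine forall_congr' fun i => ?_
    by_cases hi : i ∈ S <;> simp [hi]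
  rw [h, Fintype.card_piFinset]
  simp_rw [apply_ite Finset.card, Finset.card_singleton, Finset.card_univ]
  rw [Finset.prod_ite]
  simp [Finset.filter_not, Finset.card_sdiff]

/-- Union bound over the bins and the `m`-element sets of balls landing together. -/
lemma card_filter_exists_le_card_fiber {α β : Type*} [Fintype α] [Fintype β] (m : ℕ) :
    (Finset.univ.filter fun f : α → β =>
        ∃ b, m ≤ (Finset.univ.filter fun i => f i = b).card).card
      ≤ Fintype.card β *
        ((Fintype.card α).choose m * Fintype.card β ^ (Fintype.card α - m)) := by
  have hsub : (Finset.univ.filter fun f : α → β =>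
        ∃ b, m ≤ (Finset.univ.filter fun i => f i = b).card)
      ⊆ Finset.univ.biUnion fun b : β => (Finset.powersetCard m Finset.univ).biUnion
        fun S : Finset α => Finset.univ.filter fun f : α → β => ∀ i ∈ S, f i = b := by
    intro f hf
    obtain ⟨b, hb⟩ := (Finset.mem_filter.1 hf).2
    obtain ⟨S, hS, hcard⟩ := Finset.exists_subset_card_eq hb
    simp only [Finset.mem_biUnion, Finset.mem_univ, true_and, Finset.mem_powersetCard,
      Finset.subset_univ, Finset.mem_filter]
    exact ⟨b, S, hcard, fun i hi => (Finset.mem_filter.1 (hS hi)).2⟩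
  refine (Finset.card_le_card hsub).trans ?_
  refine Finset.card_biUnion_le_card_mul _ _ _ fun b _ => ?_
  refine (Finset.card_biUnion_le_card_mul _ _ (Fintype.card β ^ (Fintype.card α - m))
    fun S hS => ?_).trans_eq ?_
  · rw [card_filter_forall_mem_eq, (Finset.mem_powersetCard.1 hS).2]
  · rw [Finset.card_powersetCard, Finset.card_univ]

lemma card_filter_exists_le_card_fiber_mul_factorial {α β : Type*} [Fintype α] [Fintype β]
    {m : ℕ} (hm : 1 ≤ m) (h : Fintype.card α ≤ Fintype.card β) :
    (Finset.univ.filter fun f : α → β =>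
        ∃ b, m ≤ (Finset.univ.filter fun i => f i = b).card).card * m.factorial
      ≤ Fintype.card α * Fintype.card β ^ Fintype.card α := by
  refine (Nat.mul_le_mul_right _ (card_filter_exists_le_card_fiber m)).trans ?_
  generalize Fintype.card α = k at *
  generalize Fintype.card β = n at *
  rcases lt_or_ge k m with hkm | hkm
  · simp [Nat.choose_eq_zero_of_lt hkm]
  obtain ⟨p, rfl⟩ : ∃ p, m = p + 1 := ⟨m - 1, by omega⟩
  calc n * (k.choose (p + 1) * n ^ (k - (p + 1))) * (p + 1).factorial
      = n * n ^ (k - (p + 1)) * ((p + 1).factorial * k.choose (p + 1)) := by ring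
    _ = n * n ^ (k - (p + 1)) * k.descFactorial (p + 1) := by
        rw [Nat.descFactorial_eq_factorial_mul_choose]
    _ ≤ n * n ^ (k - (p + 1)) * (k * n ^ p) := by
        gcongr
        refine (Nat.descFactorial_le_pow k (p + 1)).trans ?_
        rw [pow_succ']
        gcongr
    _ = k * n ^ (p + 1 + (k - (p + 1))) := by ring
    _ = k * n ^ k := by rw [Nat.add_sub_cancel' hkm]

lemma two_pow_lt_factorial {m : ℕ} (hm : 4 ≤ m) : 2 ^ m < m.factorial := by
  induction m, hm using Nat.le_induction with
  | base => decide
  | succ m hm ih =>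
    rw [pow_succ', Nat.factorial_succ]
    exact Nat.mul_lt_mul_of_le_of_lt (by omega) ih (by omega)

/-- Balls-in-bins lemma (the paper's Lemma 6.1): if `k` balls (`1 ≤ k ≤ N`) are thrown
independently and uniformly at random into `k' ≥ k` bins, then the probability that
some bin receives at least `γ · log₂ N` balls is less than `1 / N^(γ/3 - 2)`,
for any constant `γ ≥ 9` and `N ≥ 2`. The probability is the fraction of functions
`f : Fin k → Fin k'` (uniform product distribution) with a crowded bin. -/
theorem stmt_2 (γ : ℝ) (hγ : 9 ≤ γ) (N k k' : ℕ) (hN : 2 ≤ N)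
    (hk1 : 1 ≤ k) (hkN : k ≤ N) (hkk' : k ≤ k') :
    ((Finset.univ.filter fun f : Fin k → Fin k' =>
        ∃ b : Fin k',
          γ * Real.logb 2 N ≤ ((Finset.univ.filter fun i : Fin k => f i = b).card : ℝ)).card : ℝ)
      / ((k' : ℝ) ^ k) < 1 / (N : ℝ) ^ (γ / 3 - 2) := by
  have hN' : (2 : ℝ) ≤ N := by exact_mod_cast hN
  have hN0 : (0 : ℝ) < N := by linarith
  have hlog : 1 ≤ Real.logb 2 N := by
    rw [Real.le_logb_iff_rpow_le (by norm_num) hN0]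
    simpa using hN'
  simp_rw [← Nat.ceil_le]
  set m := ⌈γ * Real.logb 2 N⌉₊
  have hle : γ * Real.logb 2 N ≤ m := Nat.le_ceil _
  have hm9 : 9 ≤ m := by
    have : (9 : ℝ) ≤ m := by nlinarith
    exact_mod_cast this
  have hcount := card_filter_exists_le_card_fiber_mul_factorial
    (α := Fin k) (β := Fin k') (m := m) (by omega) (by simpa using hkk')
  simp only [Fintype.card_fin] at hcount
  have hpow : (N : ℝ) ^ (γ / 3 - 1) < m.factorial := by
    calc (N : ℝ) ^ (γ / 3 - 1) = 2 ^ (Real.logb 2 N * (γ / 3 - 1)) := by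
          rw [Real.rpow_mul (by norm_num), Real.rpow_logb (by norm_num) (by norm_num) hN0]
      _ ≤ 2 ^ (m : ℝ) := by
          refine Real.rpow_le_rpow_of_exponent_le (by norm_num) ?_
          nlinarith
      _ = ((2 ^ m : ℕ) : ℝ) := by rw [Real.rpow_natCast]; norm_cast
      _ < m.factorial := by exact_mod_cast two_pow_lt_factorial (by omega)
  have hk0 : (0 : ℝ) < (k' : ℝ) ^ k := by
    have : 0 < k' := by omega
    positivity
  have hfac : (0 : ℝ) < m.factorial := by exact_mod_cast m.factorial_pos
  calc _ ≤ (N : ℝ) / m.factorial := by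
        rw [div_le_div_iff₀ hk0 hfac]
        norm_cast
        refine le_trans (le_of_eq ?_) (hcount.trans (Nat.mul_le_mul_right _ hkN))
        congr!
    _ < 1 / (N : ℝ) ^ (γ / 3 - 2) := by
        rw [div_lt_div_iff₀ hfac (Real.rpow_pos_of_pos hN0 _), one_mul]
        refine lt_of_eq_of_lt ?_ hpow
        rw [show γ / 3 - 1 = 1 + (γ / 3 - 2) by ring, Real.rpow_add hN0, Real.rpow_one]
end

section
/- Fix a natural number c ≥ 1, a natural number N ≥ 2, constants β ≥ c+3 and γ ≥ 3c+9, and a number of tokens k with 1 ≤ k ≤ N. Let k' be the smallest power of 2 with k' ≥ k (so k ≤ k' < 2k). Suppose each of the k tokens is independently assigned a tag chosen uniformly at random from {1, …, N^β} and, independently, a bin chosen uniformly at random from {1, …, k'}. Then with probability at least 1 − 1/N^c, the following two properties both hold: (1) all k tags are distinct; and (2) every bin receives fewer than γ·log₂(N) tokens. -/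
open scoped Classical

open Finset in
/-- Two fixed distinct coordinates collide in their first component with probability at most
`1 / card α`. -/
theorem card_filter_fst_eq_mul_card_le {ι α β : Type*} [Fintype ι] [Fintype α] [Fintype β]
    {i j : ι} (hij : i ≠ j) :
    #{f : ι → α × β | (f i).1 = (f j).1} * Fintype.card α ≤ Fintype.card (ι → α × β) := by
  rw [← Finset.card_univ (α := α), ← Finset.card_product, ← Finset.card_univ]
  refine Finset.card_le_card_of_injOn
    (fun p => Function.update p.1 i (p.2, (p.1 i).2)) (fun _ _ => by simp) ?_
  rintro ⟨f, s⟩ hf ⟨g, t⟩ hg h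
  simp only [coe_product, Set.mem_prod, coe_filter, mem_univ, true_and, Set.mem_ofPred_eq,
    coe_univ, Set.mem_univ, and_true] at hf hg
  have hl (l : ι) := congrFun h l
  have hi : s = t ∧ (f i).2 = (g i).2 := by simpa using hl i
  have hne (l : ι) (hli : l ≠ i) : f l = g l := by simpa [hli] using hl l
  refine Prod.ext (funext fun l => ?_) hi.1
  by_cases hli : l = i
  · subst hli
    exact Prod.ext (by rw [hf, hg, hne j hij.symm]) hi.2
  · exact hne l hli

open Finset in
/-- Union bound for collisions among the first components. -/
theorem card_filter_not_injective_fst_mul_card_le {ι α β : Type*} [Fintype ι] [Fintype α]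
    [Fintype β] :
    #{f : ι → α × β | ¬ Function.Injective fun i => (f i).1} * Fintype.card α
      ≤ Fintype.card ι ^ 2 * Fintype.card (ι → α × β) := by
  have hsub : ({f : ι → α × β | ¬ Function.Injective fun i => (f i).1} : Finset _) ⊆
      (univ : Finset ι).offDiag.biUnion fun p => {f : ι → α × β | (f p.1).1 = (f p.2).1} := by
    intro f hf
    simp only [mem_filter, mem_univ, true_and, Function.Injective, not_forall] at hf
    obtain ⟨i, j, h, hij⟩ := hf
    simp only [mem_biUnion, mem_offDiag, mem_filter, mem_univ, true_and]
    exact ⟨(i, j), hij, h⟩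
  calc _ ≤ (∑ p ∈ (univ : Finset ι).offDiag, #{f : ι → α × β | (f p.1).1 = (f p.2).1})
        * Fintype.card α := Nat.mul_le_mul_right _ ((card_le_card hsub).trans card_biUnion_le)
    _ ≤ ∑ _p ∈ (univ : Finset ι).offDiag, Fintype.card (ι → α × β) := by
      rw [sum_mul]
      exact sum_le_sum fun p hp => card_filter_fst_eq_mul_card_le (mem_offDiag.1 hp).2.2
    _ ≤ _ := by
      rw [sum_const, smul_eq_mul, offDiag_card, card_univ, sq]
      exact Nat.mul_le_mul_right _ (Nat.sub_le _ _)

open Finset in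
/-- The generating function of the load of a bin, evaluated at `2`. -/
theorem sum_two_pow_card_filter_snd_eq {ι α β : Type*} [Fintype ι] [Fintype α] [Fintype β]
    (b : β) :
    ∑ f : ι → α × β, 2 ^ #{i | (f i).2 = b}
      = (Fintype.card α * (Fintype.card β + 1)) ^ Fintype.card ι := by
  have hprod (f : ι → α × β) :
      2 ^ #{i | (f i).2 = b} = ∏ i, if (f i).2 = b then 2 else 1 := by
    rw [prod_ite]; simp
  have hsum : ∑ x : α × β, (if x.2 = b then 2 else 1)
      = Fintype.card α * (Fintype.card β + 1) := by
    have h (x : β) : (if x = b then 2 else 1) = 1 + if x = b then 1 else 0 := by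
      split_ifs <;> rfl
    simp only [Fintype.sum_prod_type, h, sum_add_distrib, sum_ite_eq', mem_univ, if_true]
    simp [mul_add]
  simp_rw [hprod]
  rw [← Fintype.piFinset_univ, ← prod_univ_sum (fun _ : ι => (univ : Finset (α × β)))
    (fun _ x => if x.2 = b then 2 else 1), prod_const, hsum, card_univ]

open Finset in
/-- Exponential Markov bound and union bound for the loads of the bins. -/
theorem card_filter_exists_le_card_mul_two_rpow_le {ι α β : Type*} [Fintype ι] [Fintype α]
    [Fintype β] (L : ℝ) :
    (#{f : ι → α × β | ∃ b, L ≤ (#{i | (f i).2 = b} : ℝ)} : ℝ) * (2 : ℝ) ^ L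
      ≤ Fintype.card β *
        ((Fintype.card α : ℝ) * (Fintype.card β + 1)) ^ Fintype.card ι := by
  have hb (b : β) : (#{f : ι → α × β | L ≤ (#{i | (f i).2 = b} : ℝ)} : ℝ) * (2 : ℝ) ^ L
      ≤ ((Fintype.card α : ℝ) * (Fintype.card β + 1)) ^ Fintype.card ι := by
    have h := sum_two_pow_card_filter_snd_eq (ι := ι) (α := α) b
    have h' : ∑ f : ι → α × β, (2 : ℝ) ^ #{i | (f i).2 = b}
        = ((Fintype.card α : ℝ) * (Fintype.card β + 1)) ^ Fintype.card ι := by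
      exact_mod_cast h
    rw [← h', ← nsmul_eq_mul, ← sum_const]
    refine (sum_le_sum fun f hf => ?_).trans
      (sum_le_sum_of_subset_of_nonneg (filter_subset _ _) fun _ _ _ => by positivity)
    rw [← Real.rpow_natCast]
    exact Real.rpow_le_rpow_of_exponent_le one_le_two (mem_filter.1 hf).2
  have hsub : ({f : ι → α × β | ∃ b, L ≤ (#{i | (f i).2 = b} : ℝ)} : Finset _) ⊆
      (univ : Finset β).biUnion fun b => {f : ι → α × β | L ≤ (#{i | (f i).2 = b} : ℝ)} := by
    intro f hf
    simpa using hf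
  calc _ ≤ ((∑ b : β, #{f : ι → α × β | L ≤ (#{i | (f i).2 = b} : ℝ)} : ℕ) : ℝ)
        * (2 : ℝ) ^ L := by
        gcongr
        exact (card_le_card hsub).trans card_biUnion_le
    _ ≤ ∑ _b : β, ((Fintype.card α : ℝ) * (Fintype.card β + 1)) ^ Fintype.card ι := by
      push_cast
      rw [sum_mul]
      exact sum_le_sum fun b _ => hb b
    _ = _ := by rw [sum_const, nsmul_eq_mul, card_univ]

theorem add_one_pow_le_three_mul_pow {k n : ℕ} (hn : 0 < n) (hkn : k ≤ n) :
    ((n : ℝ) + 1) ^ k ≤ 3 * (n : ℝ) ^ k := by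
  have hn' : (0 : ℝ) < n := by exact_mod_cast hn
  have h1 : (1 + 1 / (n : ℝ)) ^ k ≤ 3 := by
    calc (1 + 1 / (n : ℝ)) ^ k ≤ (Real.exp (1 / n)) ^ k := by
          gcongr
          linarith [Real.add_one_le_exp (1 / (n : ℝ))]
      _ = Real.exp (k / n) := by rw [← Real.exp_nat_mul, mul_one_div]
      _ ≤ Real.exp 1 := by
          apply Real.exp_le_exp.2
          rw [div_le_one hn']
          exact_mod_cast hkn
      _ ≤ 3 := by linarith [Real.exp_one_lt_d9]
  calc ((n : ℝ) + 1) ^ k = (1 + 1 / (n : ℝ)) ^ k * (n : ℝ) ^ k := by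
        rw [← mul_pow]; field_simp
    _ ≤ _ := by gcongr

/-- The least power of two that is at least `k ≥ 1` is at most `2 * k`. -/
theorem le_two_mul_of_least_two_pow {k k' : ℕ} (hk : 1 ≤ k)
    (hmin : ∀ p : ℕ, (∃ m : ℕ, p = 2 ^ m) → k ≤ p → k' ≤ p) : k' ≤ 2 * k := by
  refine (hmin _ ⟨Nat.log 2 k + 1, rfl⟩ (Nat.lt_pow_succ_log_self one_lt_two k).le).trans ?_
  rw [pow_succ, mul_comm]
  exact Nat.mul_le_mul_left 2 (Nat.pow_log_le_self 2 (by omega))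

/-- The paper's Lemma 6.2 on good configurations (for the instance whose number of bins
`k'` is the smallest power of 2 that is at least `k`): if each of the `k` tokens
(`1 ≤ k ≤ N`) independently receives a uniformly random tag from `{1, …, N^β}` and a
uniformly random bin from `{1, …, k'}`, then with probability at least `1 - 1/N^c`
all tags are distinct and every bin receives fewer than `γ · log₂ N` tokens,
provided `c ≥ 1`, `N ≥ 2`, `β ≥ c + 3`, and `γ ≥ 3c + 9`. The probability is the
fraction of configurations `f : Fin k → Fin (N^β) × Fin k'` that are good. -/
theorem stmt_4 (c N β k k' : ℕ) (γ : ℝ) (hc : 1 ≤ c) (hN : 2 ≤ N)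
    (hβ : c + 3 ≤ β) (hγ : (3 * c + 9 : ℝ) ≤ γ) (hk1 : 1 ≤ k) (hkN : k ≤ N)
    (hpow : ∃ m : ℕ, k' = 2 ^ m) (hge : k ≤ k')
    (hmin : ∀ p : ℕ, (∃ m : ℕ, p = 2 ^ m) → k ≤ p → k' ≤ p) :
    (1 : ℝ) - 1 / (N : ℝ) ^ c ≤
      ((Finset.univ.filter fun f : Fin k → Fin (N ^ β) × Fin k' =>
          Function.Injective (fun i : Fin k => (f i).1) ∧
          ∀ b : Fin k',
            ((Finset.univ.filter fun i : Fin k => (f i).2 = b).card : ℝ)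
              < γ * Real.logb 2 N).card : ℝ)
        / (((N : ℝ) ^ β * (k' : ℝ)) ^ k) := by
  have hB : 0 < k' := by omega
  have hN1 : (1 : ℝ) ≤ N := by exact_mod_cast (by omega : 1 ≤ N)
  have hN2 : (2 : ℝ) ≤ N := by exact_mod_cast hN
  have hN0 : (0 : ℝ) < N := by linarith
  have hB0 : (0 : ℝ) < k' := by exact_mod_cast hB
  have hB2 : (k' : ℝ) ≤ 2 * N := by
    exact_mod_cast (le_two_mul_of_least_two_pow hk1 hmin).trans (Nat.mul_le_mul_left 2 hkN)
  have hkN' : (k : ℝ) ≤ N := by exact_mod_cast hkN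
  set W : ℝ := ((N : ℝ) ^ β * (k' : ℝ)) ^ k with hW
  have hW0 : 0 < W := by positivity
  set L : ℝ := γ * Real.logb 2 N with hL
  have hcard : (Fintype.card (Fin k → Fin (N ^ β) × Fin k') : ℝ) = W := by simp [hW]
  set C : Finset (Fin k → Fin (N ^ β) × Fin k') :=
    Finset.univ.filter fun f => ¬ Function.Injective fun i => (f i).1 with hC
  set D : Finset (Fin k → Fin (N ^ β) × Fin k') := Finset.univ.filter fun f =>
    ∃ b, L ≤ ((Finset.univ.filter fun i : Fin k => (f i).2 = b).card : ℝ) with hD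
  have hcollide : (C.card : ℝ) ≤ W / (2 * (N : ℝ) ^ c) := by
    have h : (C.card : ℝ) * (N : ℝ) ^ β ≤ (k : ℝ) ^ 2 * W := by
      rw [← hcard]
      have := card_filter_not_injective_fst_mul_card_le
        (ι := Fin k) (α := Fin (N ^ β)) (β := Fin k')
      rw [Fintype.card_fin, Fintype.card_fin] at this
      have hnat : C.card * N ^ β ≤ k ^ 2 * Fintype.card (Fin k → Fin (N ^ β) × Fin k') := by
        convert this
      exact_mod_cast hnat
    have hpow : (N : ℝ) ^ c * (N : ℝ) ^ 3 ≤ (N : ℝ) ^ β := by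
      rw [← pow_add]
      exact pow_le_pow_right₀ hN1 hβ
    rw [le_div_iff₀ (by positivity)]
    refine le_of_mul_le_mul_right ?_ (by positivity : (0 : ℝ) < N ^ 2)
    calc (C.card : ℝ) * (2 * (N : ℝ) ^ c) * N ^ 2
        ≤ C.card * ((N : ℝ) * (N : ℝ) ^ c) * N ^ 2 := by gcongr
      _ = C.card * ((N : ℝ) ^ c * (N : ℝ) ^ 3) := by ring
      _ ≤ C.card * (N : ℝ) ^ β := by gcongr
      _ ≤ (k : ℝ) ^ 2 * W := h
      _ ≤ (N : ℝ) ^ 2 * W := by gcongr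
      _ = W * N ^ 2 := mul_comm _ _
  have hcrowd : (D.card : ℝ) ≤ W / (2 * (N : ℝ) ^ c) := by
    have h : (D.card : ℝ) * (2 : ℝ) ^ L ≤ k' * ((N : ℝ) ^ β * (k' + 1)) ^ k := by
      have := card_filter_exists_le_card_mul_two_rpow_le
        (ι := Fin k) (α := Fin (N ^ β)) (β := Fin k') L
      rw [Fintype.card_fin, Fintype.card_fin, Fintype.card_fin, Nat.cast_pow] at this
      convert this
    have h3 : ((N : ℝ) ^ β * (k' + 1)) ^ k ≤ 3 * W := by
      rw [hW, mul_pow, mul_pow, mul_left_comm]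
      gcongr
      exact add_one_pow_le_three_mul_pow hB hge
    have hpow : (N : ℝ) ^ c * ((N : ℝ) * 12) ≤ (2 : ℝ) ^ L := by
      calc (N : ℝ) ^ c * ((N : ℝ) * 12) ≤ (N : ℝ) ^ c * ((N : ℝ) * N ^ 4) := by
            gcongr
            calc (12 : ℝ) ≤ 2 ^ 4 := by norm_num
              _ ≤ (N : ℝ) ^ 4 := by gcongr
        _ = (N : ℝ) ^ (c + 5) := by ring
        _ ≤ (N : ℝ) ^ (3 * c + 9) := pow_le_pow_right₀ hN1 (by omega)
        _ = (N : ℝ) ^ ((3 * c + 9 : ℕ) : ℝ) := (Real.rpow_natCast _ _).symm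
        _ ≤ (N : ℝ) ^ γ := Real.rpow_le_rpow_of_exponent_le hN1 (by exact_mod_cast hγ)
        _ = (2 : ℝ) ^ L := by
            rw [hL, mul_comm, Real.rpow_mul zero_le_two,
              Real.rpow_logb two_pos (by norm_num) hN0]
    rw [le_div_iff₀ (by positivity)]
    refine le_of_mul_le_mul_right ?_ (by positivity : (0 : ℝ) < 6 * N)
    calc (D.card : ℝ) * (2 * (N : ℝ) ^ c) * (6 * N)
        = D.card * ((N : ℝ) ^ c * ((N : ℝ) * 12)) := by ring
      _ ≤ D.card * (2 : ℝ) ^ L := by gcongr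
      _ ≤ k' * ((N : ℝ) ^ β * (k' + 1)) ^ k := h
      _ ≤ (2 * N) * (3 * W) := by gcongr
      _ = W * (6 * N) := by ring
  rw [le_div_iff₀ hW0]
  set G : Finset (Fin k → Fin (N ^ β) × Fin k') := Finset.univ.filter fun f =>
    Function.Injective (fun i : Fin k => (f i).1) ∧
      ∀ b : Fin k', ((Finset.univ.filter fun i : Fin k => (f i).2 = b).card : ℝ) < L with hG
  have hcover : Finset.univ ⊆ G ∪ (C ∪ D) := by
    intro f _
    simp only [hG, hC, hD, Finset.mem_union, Finset.mem_filter, Finset.mem_univ, true_and]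
    by_cases h1 : Function.Injective fun i => (f i).1
    · by_cases h2 : ∃ b, L ≤ ((Finset.univ.filter fun i : Fin k => (f i).2 = b).card : ℝ)
      · exact Or.inr (Or.inr h2)
      · push Not at h2
        exact Or.inl ⟨h1, h2⟩
    · exact Or.inr (Or.inl h1)
  have hunion : W ≤ G.card + (C.card + D.card) := by
    rw [← hcard, ← Finset.card_univ]
    exact_mod_cast (Finset.card_le_card hcover).trans ((Finset.card_union_le _ _).trans
      (Nat.add_le_add_left (Finset.card_union_le _ _) _))
  have hhalf : 1 / (N : ℝ) ^ c * W = W / (2 * (N : ℝ) ^ c) + W / (2 * (N : ℝ) ^ c) := by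
    field_simp
    ring
  rw [sub_mul, one_mul, hhalf]
  linarith
end

section
/- Let G = (V,E) be a finite simple graph with |V| = n vertices, and let α > 0 be a real number such that for every nonempty set S' ⊆ V with |S'| ≤ n/2, the boundary ∂S' = {v ∈ V∖S' : some u ∈ S' is adjacent to v} satisfies |∂S'| ≥ α·|S'|. Then for every nonempty S ⊂ V with |S| ≤ n/2, there exists a set of at least |S|·(α/4) edges of G, each joining a vertex of S to a vertex of V∖S, such that no two of these edges share an endpoint (i.e., the bipartite graph B_G(S) consisting of all edges of G between S and V∖S has a matching of size at least |S|·α/4). -/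
open scoped Classical

/-- The defect version of Hall's theorem: if every `X ⊆ S` has at least `|X| - d` neighbours
under `t`, then there is a matching that covers all but at most `d` elements of `S`. -/
theorem exists_matching_of_card_le_card_biUnion_add {ι β : Type*}
    [Fintype ι] [Fintype β] [DecidableEq β]
    (S : Finset ι) (t : ι → Finset β) (d : ℕ)
    (h : ∀ X ⊆ S, X.card ≤ (X.biUnion t).card + d) :
    ∃ M : Finset (ι × β),
      (∀ e ∈ M, e.1 ∈ S ∧ e.2 ∈ t e.1) ∧
      (∀ e ∈ M, ∀ e' ∈ M, e.1 = e'.1 ∨ e.2 = e'.2 → e = e') ∧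
      S.card ≤ M.card + d := by
  let t' : S → Finset (β ⊕ Fin d) := fun x => (t x).disjSum Finset.univ
  have hall : ∀ Y : Finset S, Y.card ≤ (Y.biUnion t').card := by
    intro Y
    rcases Y.eq_empty_or_nonempty with rfl | ⟨y, hy⟩
    · simp
    have hsub : ((Y.map (Function.Embedding.subtype _)).biUnion t).disjSum
        (Finset.univ : Finset (Fin d)) ⊆ Y.biUnion t' := by
      rintro (b | k) hb
      · simp only [Finset.inl_mem_disjSum, Finset.mem_biUnion, Finset.mem_map] at hb
        obtain ⟨_, ⟨x, hx, rfl⟩, hb⟩ := hb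
        exact Finset.mem_biUnion.2 ⟨x, hx, Finset.inl_mem_disjSum.2 hb⟩
      · exact Finset.mem_biUnion.2 ⟨y, hy, Finset.inr_mem_disjSum.2 (Finset.mem_univ k)⟩
    have hY := h (Y.map (Function.Embedding.subtype _)) (by
      intro x hx
      obtain ⟨z, -, rfl⟩ := Finset.mem_map.1 hx
      exact z.2)
    have hcard := Finset.card_le_card hsub
    rw [Finset.card_disjSum, Finset.card_univ, Fintype.card_fin] at hcard
    rw [Finset.card_map] at hY
    exact hY.trans hcard
  obtain ⟨f, hf, hft⟩ :=
    (Finset.all_card_le_biUnion_card_iff_exists_injective t').1 hall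
  refine ⟨Finset.univ.filter fun e => ∃ hx : e.1 ∈ S, f ⟨e.1, hx⟩ = Sum.inl e.2, ?_, ?_, ?_⟩
  · intro e he
    obtain ⟨hx, hfe⟩ := (Finset.mem_filter.1 he).2
    have hmem := hft ⟨e.1, hx⟩
    rw [hfe] at hmem
    exact ⟨hx, Finset.inl_mem_disjSum.1 hmem⟩
  · rintro ⟨x, y⟩ he ⟨x', y'⟩ he' heq
    obtain ⟨hx, hfe⟩ := (Finset.mem_filter.1 he).2
    obtain ⟨hx', hfe'⟩ := (Finset.mem_filter.1 he').2
    dsimp only at hx hfe hx' hfe' heq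
    rcases heq with rfl | rfl
    · rw [Sum.inl.inj (hfe.symm.trans hfe')]
    · rw [Subtype.mk.inj (hf (hfe.trans hfe'.symm))]
  · set M : Finset (ι × β) :=
      Finset.univ.filter fun e => ∃ hx : e.1 ∈ S, f ⟨e.1, hx⟩ = Sum.inl e.2 with hM
    have hsub : Finset.univ.image f ⊆
        (M.image Prod.snd).disjSum (Finset.univ : Finset (Fin d)) := by
      intro z hz
      obtain ⟨x, -, rfl⟩ := Finset.mem_image.1 hz
      rcases hfx : f x with b | k
      · refine Finset.inl_mem_disjSum.2 (Finset.mem_image.2 ⟨(x, b), ?_, rfl⟩)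
        exact Finset.mem_filter.2 ⟨Finset.mem_univ _, x.2, hfx⟩
      · exact Finset.inr_mem_disjSum.2 (Finset.mem_univ k)
    have hcard := Finset.card_le_card hsub
    rw [Finset.card_image_of_injective _ hf, Finset.card_univ, Fintype.card_coe,
      Finset.card_disjSum, Finset.card_univ, Fintype.card_fin] at hcard
    exact hcard.trans (Nat.add_le_add_right Finset.card_image_le d)

/-- The paper's Lemma 7.3: in a finite simple graph `G` on `n` vertices with vertex
expansion at least `α` (every nonempty `S'` with `|S'| ≤ n/2` has boundary of size at
least `α·|S'|`), for every nonempty `S` with `|S| ≤ n/2` the bipartite graph `B_G(S)`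
of edges between `S` and `V∖S` has a matching of size at least `|S|·(α/4)`:
a set of at least `|S|·α/4` crossing edges, no two of which share an endpoint. -/
theorem stmt_6 {V : Type*} [Fintype V] [DecidableEq V] (G : SimpleGraph V)
    (n : ℕ) (hn : n = Fintype.card V) (α : ℝ) (hα : 0 < α)
    (hexp : ∀ S' : Finset V, S'.Nonempty → 2 * S'.card ≤ n →
      α * (S'.card : ℝ) ≤
        ((Finset.univ.filter fun v : V => v ∉ S' ∧ ∃ u ∈ S', G.Adj u v).card : ℝ))
    (S : Finset V) (hS : S.Nonempty) (hScard : 2 * S.card ≤ n) :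
    ∃ M : Finset (V × V),
      (∀ e ∈ M, e.1 ∈ S ∧ e.2 ∉ S ∧ G.Adj e.1 e.2) ∧
      (∀ e ∈ M, ∀ e' ∈ M, e ≠ e' →
        e.1 ≠ e'.1 ∧ e.1 ≠ e'.2 ∧ e.2 ≠ e'.1 ∧ e.2 ≠ e'.2) ∧
      (S.card : ℝ) * (α / 4) ≤ (M.card : ℝ) := by
  have hSpos : 0 < S.card := hS.card_pos
  have hα2 : α ≤ 2 := by
    obtain ⟨T, -, hT⟩ := Finset.exists_subset_card_eq
      (s := (Finset.univ : Finset V)) (n := n / 2) (by rw [Finset.card_univ]; omega)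
    have hexpT := hexp T (Finset.card_pos.1 (by omega)) (by omega)
    have hle : (Finset.univ.filter fun v : V => v ∉ T ∧ ∃ u ∈ T, G.Adj u v).card ≤
        2 * T.card := by
      refine (Finset.card_le_card (t := Tᶜ) fun v hv => ?_).trans ?_
      · exact Finset.mem_compl.2 (Finset.mem_filter.1 hv).2.1
      · rw [Finset.card_compl]
        omega
    have hle' : ((Finset.univ.filter fun v : V => v ∉ T ∧ ∃ u ∈ T, G.Adj u v).card : ℝ) ≤
        2 * (T.card : ℝ) := by exact_mod_cast hle
    have hTpos : (0 : ℝ) < T.card := by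
      exact_mod_cast (show 0 < T.card by omega)
    exact le_of_mul_le_mul_right (hexpT.trans hle') hTpos
  have hs0 : (0 : ℝ) < S.card := by exact_mod_cast hSpos
  set m := ⌈(S.card : ℝ) * (α / 4)⌉₊ with hm
  have hmS : m ≤ S.card := Nat.ceil_le.2 (by nlinarith)
  let t : V → Finset V := fun u => Finset.univ.filter fun v => v ∉ S ∧ G.Adj u v
  obtain ⟨M, hMt, hMinj, hMcard⟩ :=
    exists_matching_of_card_le_card_biUnion_add S t (S.card - m) (by
      intro X hX
      rcases X.eq_empty_or_nonempty with rfl | hXne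
      · simp
      have hXS := Finset.card_le_card hX
      have hbd := hexp X hXne (by omega)
      have hle : (Finset.univ.filter fun v : V => v ∉ X ∧ ∃ u ∈ X, G.Adj u v).card ≤
          (S \ X).card + (X.biUnion t).card := by
        refine (Finset.card_le_card fun v hv => ?_).trans (Finset.card_union_le _ _)
        obtain ⟨-, hvX, u, hu, huv⟩ := Finset.mem_filter.1 hv
        by_cases hvS : v ∈ S
        · exact Finset.mem_union_left _ (Finset.mem_sdiff.2 ⟨hvS, hvX⟩)
        · exact Finset.mem_union_right _ (Finset.mem_biUnion.2
            ⟨u, hu, Finset.mem_filter.2 ⟨Finset.mem_univ v, hvS, huv⟩⟩)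
      rw [Finset.card_sdiff_of_subset hX] at hle
      have hc : m ≤ S.card - X.card + (X.biUnion t).card := by
        refine Nat.ceil_le.2 ?_
        have h₁ : α * (X.card : ℝ) ≤
            ((S.card - X.card + (X.biUnion t).card : ℕ) : ℝ) :=
          hbd.trans (by exact_mod_cast hle)
        have h₂ : (S.card : ℝ) ≤
            X.card + ((S.card - X.card + (X.biUnion t).card : ℕ) : ℝ) := by
          exact_mod_cast (show S.card ≤
            X.card + (S.card - X.card + (X.biUnion t).card) by omega)
        have h₃ : (0 : ℝ) ≤ ((S.card - X.card + (X.biUnion t).card : ℕ) : ℝ) :=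
          Nat.cast_nonneg _
        generalize ((S.card - X.card + (X.biUnion t).card : ℕ) : ℝ) = c at h₁ h₂ h₃ ⊢
        nlinarith [mul_le_mul_of_nonneg_left h₂ hα.le, mul_le_mul_of_nonneg_right hα2 h₃]
      omega)
  have hcross : ∀ e ∈ M, e.1 ∈ S ∧ e.2 ∉ S ∧ G.Adj e.1 e.2 := fun e he =>
    ⟨(hMt e he).1, (Finset.mem_filter.1 (hMt e he).2).2⟩
  refine ⟨M, hcross, fun e he e' he' hne => ⟨?_, ?_, ?_, ?_⟩, ?_⟩
  · exact fun heq => hne (hMinj e he e' he' (Or.inl heq))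
  · exact fun heq => (hcross e' he').2.1 (heq ▸ (hcross e he).1)
  · exact fun heq => (hcross e he).2.1 (heq ▸ (hcross e' he').1)
  · exact fun heq => hne (hMinj e he e' he' (Or.inr heq))
  · exact (Nat.le_ceil _).trans (by exact_mod_cast (show m ≤ M.card by omega))
end
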